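/- Let d ≥ 1 and let Φ, ψ ∈ C^∞ with Φ real-valued and supp ψ ⊂ B(0,1) ⊂ ℝ^d. Suppose there is μ > 0 with |∇Φ(x) − ∇Φ(y)| ≥ μ|x − y| for all x, y ∈ B(0,1), and let x_c be the critical point of Φ (∇Φ(x_c) = 0), with x_c ∈ supp ψ. Set λ₀ := 𝒫₃² 𝒫₂ μ^{-4}. Then for every ε > 0 there is a constant C_ε such that, whenever λ ≥ λ₀^{1+ε}, |∫_{ℝ^d} e^{iλΦ(x)} ψ(x) dx| ≤ C_ε · 𝔠_{N_ε} · (1 + |det HΦ(x_c)|^{-1/2}) · λ^{-d/2}, where 𝔠_n := (1 + (𝒫_n/𝒫₃)^n) 𝒜_n and N_ε = [d(1+ε)/ε] + 1. -/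

import Mathlib

open MeasureTheory Metric Set

noncomputable section

/-- Euclidean space `ℝ^d`. -/
abbrev Euc (d : ℕ) : Type := EuclideanSpace ℝ (Fin d)

/-- Supremum over `s` of the norm of the `i`-th iterated (Fréchet) derivative of `f`. -/
noncomputable def supDeriv {d : ℕ} {F : Type*} [NormedAddCommGroup F] [NormedSpace ℝ F]
    (i : ℕ) (f : Euc d → F) (s : Set (Euc d)) : ℝ :=
  sSup ((fun x => ‖iteratedFDeriv ℝ i f x‖) '' s)

/-- The `C^k` norm of `f` on the set `s` (`k` a natural number):
sum of the sup-norms of all derivatives of order up to `k`. -/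
noncomputable def CnormNat {d : ℕ} {F : Type*} [NormedAddCommGroup F] [NormedSpace ℝ F]
    (k : ℕ) (f : Euc d → F) (s : Set (Euc d)) : ℝ :=
  ∑ j ∈ Finset.range (k + 1), supDeriv j f s

/-- The quantity `𝒫_r` (integer `r`): sizes of all derivatives of `Φ` of orders `2,…,r` on `s`. -/
noncomputable def Pnorm {d : ℕ} (r : ℕ) (Φ : Euc d → ℝ) (s : Set (Euc d)) : ℝ :=
  ∑ j ∈ Finset.Icc 2 r, supDeriv j Φ s

/-- The Hessian matrix of `Φ` at `x`. -/
noncomputable def Hess {d : ℕ} (Φ : Euc d → ℝ) (x : Euc d) : Matrix (Fin d) (Fin d) ℝ :=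
  Matrix.of fun i j =>
    iteratedFDeriv ℝ 2 Φ x ![EuclideanSpace.single i (1 : ℝ), EuclideanSpace.single j (1 : ℝ)]

/-- `L^*(Φ) = inf_{x ∈ s} |det HΦ(x)|`. -/
noncomputable def LStar {d : ℕ} (Φ : Euc d → ℝ) (s : Set (Euc d)) : ℝ :=
  sInf ((fun x => |(Hess Φ x).det|) '' s)

/-- The oscillatory integral `I(λ, Φ, ψ) = ∫ e^{iλΦ(x)} ψ(x) dx`. -/
noncomputable def oscInt {d : ℕ} (lam : ℝ) (Φ : Euc d → ℝ) (ψ : Euc d → ℂ) : ℂ :=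
  ∫ x : Euc d, Complex.exp (Complex.I * (lam : ℂ) * (Φ x : ℂ)) * ψ x

section Derivatives

variable {E F : Type*} [NormedAddCommGroup E] [NormedSpace ℝ E]
  [NormedAddCommGroup F] [NormedSpace ℝ F]

lemma norm_iteratedFDeriv_cexp_ofReal_le (n : ℕ) (t : ℝ) :
    ‖iteratedFDeriv ℝ n (fun s : ℝ => Complex.exp (Complex.I * s)) t‖ ≤ 1 := by
  have key : ∀ n : ℕ, iteratedDeriv n (fun s : ℝ => Complex.exp (Complex.I * s)) =
      fun s : ℝ => Complex.I ^ n * Complex.exp (Complex.I * s) := by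
    intro n
    induction n with
    | zero => simp
    | succ k ih =>
      rw [iteratedDeriv_succ, ih]
      funext s
      have h : HasDerivAt (fun s : ℝ => Complex.exp (Complex.I * s))
          (Complex.exp (Complex.I * s) * (Complex.I * 1)) s :=
        ((Complex.ofRealCLM.hasDerivAt (x := s)).const_mul Complex.I).cexp
      rw [(h.const_mul (Complex.I ^ k)).deriv]
      ring
  rw [norm_iteratedFDeriv_eq_norm_iteratedDeriv, key]
  simp [mul_comm Complex.I, Complex.norm_exp_ofReal_mul_I]

lemma contDiff_cexp_I_mul {Q : E → ℝ} (hQ : ContDiff ℝ (⊤ : ℕ∞) Q) :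
    ContDiff ℝ (⊤ : ℕ∞) (fun z => Complex.exp (Complex.I * Q z)) :=
  (contDiff_const.mul (Complex.ofRealCLM.contDiff.comp hQ)).cexp

lemma norm_iteratedFDeriv_cexp_phase_le {Q : E → ℝ} (hQ : ContDiff ℝ (⊤ : ℕ∞) Q) {n : ℕ} {z : E}
    {D : ℝ} (hD : ∀ i, 1 ≤ i → i ≤ n → ‖iteratedFDeriv ℝ i Q z‖ ≤ D ^ i) :
    ‖iteratedFDeriv ℝ n (fun z => Complex.exp (Complex.I * Q z)) z‖ ≤ n.factorial * D ^ n := by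
  have hg : ContDiff ℝ (⊤ : ℕ∞) (fun s : ℝ => Complex.exp (Complex.I * s)) :=
    contDiff_cexp_I_mul contDiff_id
  have := norm_iteratedFDeriv_comp_le hg hQ (n := n) (by exact_mod_cast le_top) z (C := 1)
    (fun i _ => norm_iteratedFDeriv_cexp_ofReal_le i _) hD
  simpa [Function.comp_def] using this

lemma norm_iteratedFDeriv_mul_le_of_le {A : Type*} [NormedRing A] [NormedAlgebra ℝ A]
    {f g : E → A} (hf : ContDiff ℝ (⊤ : ℕ∞) f) (hg : ContDiff ℝ (⊤ : ℕ∞) g) {n N : ℕ} (hn : n ≤ N)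
    {z : E} {a b : ℝ}
    (ha : ∀ k ≤ N, ‖iteratedFDeriv ℝ k f z‖ ≤ a) (hb : ∀ k ≤ N, ‖iteratedFDeriv ℝ k g z‖ ≤ b) :
    ‖iteratedFDeriv ℝ n (fun y => f y * g y) z‖ ≤ 2 ^ N * (a * b) := by
  have ha0 : 0 ≤ a := (norm_nonneg _).trans (ha 0 (Nat.zero_le _))
  have hb0 : 0 ≤ b := (norm_nonneg _).trans (hb 0 (Nat.zero_le _))
  calc _ ≤ _ := norm_iteratedFDeriv_mul_le hf hg z (n := n) (by exact_mod_cast le_top)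
    _ ≤ ∑ i ∈ Finset.range (n + 1), (n.choose i : ℝ) * (a * b) := by
        refine Finset.sum_le_sum fun i hi => ?_
        have hi : i ≤ n := Nat.lt_succ_iff.mp (Finset.mem_range.mp hi)
        rw [mul_assoc]
        gcongr
        · exact ha i (hi.trans hn)
        · exact hb (n - i) ((Nat.sub_le _ _).trans hn)
    _ = 2 ^ n * (a * b) := by
        rw [← Finset.sum_mul]
        congr 1
        exact_mod_cast Nat.sum_range_choose n
    _ ≤ 2 ^ N * (a * b) := by
        gcongr
        norm_num

lemma iteratedFDeriv_comp_affine {G : Type*} [NormedAddCommGroup G] [NormedSpace ℝ G] {f : F → G}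
    (hf : ContDiff ℝ (⊤ : ℕ∞) f) (p : F) (A : E →L[ℝ] F) (k : ℕ) (z : E) :
    iteratedFDeriv ℝ k (fun z => f (p + A z)) z =
      (iteratedFDeriv ℝ k f (p + A z)).compContinuousLinearMap fun _ => A := by
  have h : ContDiff ℝ (⊤ : ℕ∞) (fun y => f (p + y)) := hf.comp (contDiff_const.add contDiff_id)
  have := A.iteratedFDeriv_comp_right h z (i := k) (by exact_mod_cast le_top)
  rw [iteratedFDeriv_comp_add_left] at this
  exact this

lemma norm_iteratedFDeriv_comp_affine_le {G : Type*} [NormedAddCommGroup G] [NormedSpace ℝ G]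
    {f : F → G} (hf : ContDiff ℝ (⊤ : ℕ∞) f) (p : F) (A : E →L[ℝ] F) (k : ℕ) (z : E) :
    ‖iteratedFDeriv ℝ k (fun z => f (p + A z)) z‖ ≤
      ‖iteratedFDeriv ℝ k f (p + A z)‖ * ‖A‖ ^ k := by
  rw [iteratedFDeriv_comp_affine hf]
  simpa using (iteratedFDeriv ℝ k f (p + A z)).norm_compContinuousLinearMap_le fun _ => A

lemma contDiff_comp_affine {G : Type*} [NormedAddCommGroup G] [NormedSpace ℝ G]
    {f : F → G} (hf : ContDiff ℝ (⊤ : ℕ∞) f) (p : F) (A : E →L[ℝ] F) :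
    ContDiff ℝ (⊤ : ℕ∞) (fun z => f (p + A z)) :=
  hf.comp (contDiff_const.add A.contDiff)

lemma iteratedFDeriv_eq_zero_of_support_subset {f : E → F} {s : Set E} (hs : IsClosed s)
    (hf : Function.support f ⊆ s) {z : E} (hz : z ∉ s) (n : ℕ) : iteratedFDeriv ℝ n f z = 0 := by
  by_contra h
  exact hz (hs.closure_subset_iff.mpr hf (support_iteratedFDeriv_subset (𝕜 := ℝ) n h))

/-- Removing the first-order Taylor polynomial leaves derivatives of order `≥ 2` unchanged. -/
lemma norm_iteratedFDeriv_sub_affine {f : E → ℝ} (hf : ContDiff ℝ (⊤ : ℕ∞) f) (c : ℝ)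
    (L : E →L[ℝ] ℝ) {k : ℕ} (hk : 2 ≤ k) (z : E) :
    ‖iteratedFDeriv ℝ k (fun z => f z - (c + L z)) z‖ = ‖iteratedFDeriv ℝ k f z‖ := by
  obtain ⟨j, rfl⟩ : ∃ j, k = j + 1 := ⟨k - 1, by omega⟩
  have hfd : Differentiable ℝ f := hf.differentiable (by simp)
  have h1 : fderiv ℝ (fun z => f z - (c + L z)) = fun z => fderiv ℝ f z - L := by
    funext z
    exact ((hfd z).hasFDerivAt.sub (L.hasFDerivAt.const_add c)).fderiv
  have hf' : ContDiff ℝ (⊤ : ℕ∞) (fderiv ℝ f) := hf.fderiv_right (by simp)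
  rw [← norm_iteratedFDeriv_fderiv, ← norm_iteratedFDeriv_fderiv, h1]
  have h2 := iteratedFDeriv_sub_apply (𝕜 := ℝ) (i := j) (x := z)
    (hf'.contDiffAt.of_le (by exact_mod_cast le_top))
    (contDiffAt_const (c := L))
  have h3 : iteratedFDeriv ℝ j (fun z => fderiv ℝ f z - L) z =
      iteratedFDeriv ℝ j (fderiv ℝ f) z := by
    change iteratedFDeriv ℝ j (fderiv ℝ f - fun _ => L) z = _
    rw [h2, iteratedFDeriv_const_of_ne (by omega)]
    simp
  rw [h3]

lemma norm_fderiv_fderiv {f : E → F} (z : E) :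
    ‖fderiv ℝ (fderiv ℝ f) z‖ = ‖iteratedFDeriv ℝ 2 f z‖ := by
  rw [← norm_iteratedFDeriv_fderiv (n := 1), norm_iteratedFDeriv_one]

lemma exists_iteratedFDeriv_bound {f : E → F}
    (hf : ContDiff ℝ (⊤ : ℕ∞) f) (hc : HasCompactSupport f) (N : ℕ) :
    ∃ C : ℝ, 0 ≤ C ∧ ∀ k ≤ N, ∀ z, ‖iteratedFDeriv ℝ k f z‖ ≤ C := by
  have h : ∀ k : ℕ, ∃ C, ∀ z, ‖iteratedFDeriv ℝ k f z‖ ≤ C := fun k =>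
    (hc.iteratedFDeriv (𝕜 := ℝ) k).exists_bound_of_continuous
      (hf.continuous_iteratedFDeriv (by exact_mod_cast le_top))
  choose C hC using h
  have hC0 : ∀ k, 0 ≤ C k := fun k => (norm_nonneg _).trans (hC k 0)
  refine ⟨∑ k ∈ Finset.range (N + 1), C k, Finset.sum_nonneg fun k _ => hC0 k, fun k hk z => ?_⟩
  exact (hC k z).trans (Finset.single_le_sum (fun k _ => hC0 k) (Finset.mem_range.mpr (by omega)))

end Derivatives

section OscillatoryIntegrals

variable {E : Type*} [NormedAddCommGroup E] [InnerProductSpace ℝ E] [FiniteDimensional ℝ E]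
  [MeasurableSpace E] [BorelSpace E]

lemma integral_norm_iteratedFDeriv_le {g : E → ℂ} {w : E}
    (hsupp : Function.support g ⊆ closedBall w 1) {K : ℝ} {j : ℕ}
    (hK : ∀ z, ‖iteratedFDeriv ℝ j g z‖ ≤ K) :
    ∫ v, ‖iteratedFDeriv ℝ j g v‖ ≤ K * volume.real (closedBall (0 : E) 1) := by
  have h0 : ∀ v ∉ closedBall w 1, ‖iteratedFDeriv ℝ j g v‖ = 0 := fun v hv => by
    rw [iteratedFDeriv_eq_zero_of_support_subset isClosed_closedBall hsupp hv, norm_zero]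
  rw [← setIntegral_eq_integral_of_forall_compl_eq_zero h0]
  have := norm_setIntegral_le_of_norm_le_const (μ := volume) (s := closedBall w 1)
    (f := fun v => ‖iteratedFDeriv ℝ j g v‖) (C := K) measure_closedBall_lt_top
    (fun v _ => by simpa using hK v)
  have hvol : volume.real (closedBall w 1) = volume.real (closedBall (0 : E) 1) := by
    simp [Measure.real, Measure.addHaar_closedBall_center]
  rw [hvol] at this
  exact (Real.le_norm_self _).trans this

/-- Decay of the Fourier transform of a bump supported in a unit ball. -/
lemma exists_fourier_decay (E : Type*) [NormedAddCommGroup E] [InnerProductSpace ℝ E]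
    [FiniteDimensional ℝ E] [MeasurableSpace E] [BorelSpace E] (N : ℕ) :
    ∃ C : ℝ, 0 ≤ C ∧ ∀ (g : E → ℂ) (w : E) (K : ℝ) (L : E →L[ℝ] ℝ), ContDiff ℝ (⊤ : ℕ∞) g →
      Function.support g ⊆ closedBall w 1 →
      (∀ k ≤ N, ∀ z, ‖iteratedFDeriv ℝ k g z‖ ≤ K) →
      (1 + ‖L‖) ^ N * ‖∫ z, Complex.exp (Complex.I * L z) * g z‖ ≤ C * K := by
  set V := volume.real (closedBall (0 : E) 1)
  refine ⟨2 ^ (N - 1) * (V + (2 * Real.pi) ^ N * (2 ^ N * ((N + 1) * V))), by positivity,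
    fun g w K L hg hsupp hK => ?_⟩
  set ξ : E := (InnerProductSpace.toDual ℝ E).symm L with hξ
  set η : E := -((2 * Real.pi)⁻¹ • ξ) with hη
  have hpi : (0 : ℝ) < 2 * Real.pi := by positivity
  have hcs : HasCompactSupport g :=
    HasCompactSupport.of_support_subset_isCompact (isCompact_closedBall w 1) hsupp
  have hF : ∫ z, Complex.exp (Complex.I * L z) * g z = FourierTransform.fourier g η := by
    rw [Real.fourier_eq']
    congr 1
    funext v
    have : -2 * Real.pi * inner ℝ v η = L v := by
      rw [hη, inner_neg_right, inner_smul_right, real_inner_comm, hξ,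
        InnerProductSpace.toDual_symm_apply]
      field_simp
    rw [this, smul_eq_mul, mul_comm Complex.I]
  have hηn : ‖L‖ = 2 * Real.pi * ‖η‖ := by
    rw [hη, norm_neg, norm_smul, norm_inv, Real.norm_of_nonneg hpi.le, hξ,
      LinearIsometryEquiv.norm_map]
    field_simp
  have hint : ∀ k n : ℕ, (k : ℕ∞) ≤ ⊤ → (n : ℕ∞) ≤ ⊤ →
      Integrable (fun v => ‖v‖ ^ k * ‖iteratedFDeriv ℝ n g v‖) volume := by
    intro k n _ _
    refine Continuous.integrable_of_hasCompactSupport ?_ ?_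
    · exact (continuous_norm.pow k).mul
        (hg.continuous_iteratedFDeriv (by exact_mod_cast le_top)).norm
    · exact (hcs.iteratedFDeriv (𝕜 := ℝ) n).norm.mul_left
  have hbound : ∀ n ≤ N, ‖η‖ ^ n * ‖FourierTransform.fourier g η‖ ≤
      2 ^ n * ((n + 1) * (K * V)) := by
    intro n hn
    have := Real.pow_mul_norm_iteratedFDeriv_fourier_le hg hint (k := 0) (n := n)
      le_top le_top η
    rw [norm_iteratedFDeriv_zero] at this
    refine this.trans ?_
    simp only [pow_zero, one_mul, Nat.cast_zero, mul_zero, zero_add]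
    gcongr
    calc _ ≤ ∑ p ∈ Finset.range 1 ×ˢ Finset.range (n + 1), K * V := by
          refine Finset.sum_le_sum fun p hp => ?_
          simp only [Finset.mem_product, Finset.mem_range] at hp
          have hp0 : p.1 = 0 := by omega
          simp only [hp0, pow_zero, one_mul]
          exact integral_norm_iteratedFDeriv_le hsupp (hK _ (by omega))
      _ = (n + 1) * (K * V) := by simp
  have h0 := hbound 0 (Nat.zero_le _)
  have hN := hbound N le_rfl
  rw [hF]
  calc (1 + ‖L‖) ^ N * ‖FourierTransform.fourier g η‖
      ≤ (2 ^ (N - 1) * (1 ^ N + ‖L‖ ^ N)) * ‖FourierTransform.fourier g η‖ := by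
        gcongr
        exact add_pow_le zero_le_one (norm_nonneg _) N
    _ = 2 ^ (N - 1) * (‖η‖ ^ 0 * ‖FourierTransform.fourier g η‖ + (2 * Real.pi) ^ N *
          (‖η‖ ^ N * ‖FourierTransform.fourier g η‖)) := by
        rw [hηn, mul_pow]; ring
    _ ≤ 2 ^ (N - 1) * (2 ^ 0 * (((0 : ℕ) + 1) * (K * V)) + (2 * Real.pi) ^ N *
          (2 ^ N * ((N + 1) * (K * V)))) := by gcongr
    _ = _ := by push_cast; ring

/-- Non-stationary phase at unit scale: if the phase has derivatives of order `≥ 2` of size `M`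
on a convex set containing the support of the amplitude, the integral decays in the gradient of the
phase at any point of that set. -/
lemma exists_unit_scale_bound (E : Type*) [NormedAddCommGroup E] [InnerProductSpace ℝ E]
    [FiniteDimensional ℝ E] [MeasurableSpace E] [BorelSpace E] (N : ℕ) (hN : 2 ≤ N) :
    ∃ C : ℝ, 0 ≤ C ∧ ∀ (F : E → ℝ) (b : E → ℂ) (U : Set E) (M B : ℝ) (w z₀ : E),
      ContDiff ℝ (⊤ : ℕ∞) F → ContDiff ℝ (⊤ : ℕ∞) b → Convex ℝ U → IsClosed U → 1 ≤ M → 0 ≤ B →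
      (∀ z ∈ U, ∀ k, 2 ≤ k → k ≤ N → ‖iteratedFDeriv ℝ k F z‖ ≤ M) →
      (∀ z ∈ U, ∀ k ≤ N, ‖iteratedFDeriv ℝ k b z‖ ≤ B) →
      Function.support b ⊆ U → Function.support b ⊆ closedBall w 1 →
      z₀ ∈ U → z₀ ∈ closedBall w 1 →
      (1 + ‖fderiv ℝ F z₀‖) ^ N * ‖∫ z, Complex.exp (Complex.I * F z) * b z‖ ≤ C * (M ^ N * B) := by
  obtain ⟨C, hC0, hC⟩ := exists_fourier_decay E N
  refine ⟨C * (2 ^ N * (N.factorial * 2 ^ N)), by positivity,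
    fun F b U M B w z₀ hF hb hU hUc hM hB hFM hbB hbU hbw hz₀ hz₀w => ?_⟩
  set L := fderiv ℝ F z₀ with hL
  set Q : E → ℝ := fun z => F z - (F z₀ - L z₀ + L z) with hQ
  have hQs : ContDiff ℝ (⊤ : ℕ∞) Q := hF.sub (contDiff_const.add L.contDiff)
  set g : E → ℂ := fun z => Complex.exp (Complex.I * Q z) * b z with hg
  have hes := contDiff_cexp_I_mul hQs
  have hgs : ContDiff ℝ (⊤ : ℕ∞) g := hes.mul hb
  have hsub : Function.support g ⊆ Function.support b := Function.support_mul_subset_right _ _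
  have hFd : Differentiable ℝ F := hF.differentiable (by simp)
  have hF' : ContDiff ℝ (⊤ : ℕ∞) (fderiv ℝ F) := hF.fderiv_right (by simp)
  have hQ1 : ∀ z ∈ U ∩ closedBall w 1, ∀ i, 1 ≤ i → i ≤ N →
      ‖iteratedFDeriv ℝ i Q z‖ ≤ (2 * M) ^ i := by
    intro z hz i hi hiN
    have h2M : 1 ≤ 2 * M := by linarith
    obtain rfl | h2 : i = 1 ∨ 2 ≤ i := by omega
    · have h1 : fderiv ℝ Q z = fderiv ℝ F z - L :=
        ((hFd z).hasFDerivAt.sub (L.hasFDerivAt.const_add _)).fderiv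
      rw [norm_iteratedFDeriv_one, h1, pow_one]
      have h3 := Convex.norm_image_sub_le_of_norm_fderiv_le (𝕜 := ℝ) (f := fderiv ℝ F) (s := U)
        (C := M) (x := z₀) (y := z) (fun x _ => hF'.differentiable (by simp) x)
        (fun x hx => by rw [norm_fderiv_fderiv]; exact hFM x hx 2 le_rfl hN) hU hz₀ hz.1
      have h4 : ‖z - z₀‖ ≤ 2 := by
        have := dist_triangle_right z z₀ w
        rw [← dist_eq_norm]
        linarith [mem_closedBall.mp hz.2, mem_closedBall.mp hz₀w]
      calc _ ≤ M * ‖z - z₀‖ := h3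
        _ ≤ M * 2 := by gcongr
        _ = _ := mul_comm _ _
    · rw [norm_iteratedFDeriv_sub_affine hF _ _ h2]
      calc _ ≤ M := hFM z hz.1 i h2 hiN
        _ ≤ 2 * M := by linarith
        _ ≤ (2 * M) ^ i := le_self_pow₀ h2M (by omega)
  have hgb : ∀ k ≤ N, ∀ z, ‖iteratedFDeriv ℝ k g z‖ ≤ 2 ^ N * (N.factorial * (2 * M) ^ N * B) := by
    intro k hk z
    by_cases hz : z ∈ U ∩ closedBall w 1
    · refine norm_iteratedFDeriv_mul_le_of_le hes hb hk (fun j hj => ?_) (hbB z hz.1)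
      calc _ ≤ (j.factorial : ℝ) * (2 * M) ^ j :=
            norm_iteratedFDeriv_cexp_phase_le hQs fun i hi hij => hQ1 z hz i hi (hij.trans hj)
        _ ≤ N.factorial * (2 * M) ^ N := by
            gcongr
            linarith
    · rw [iteratedFDeriv_eq_zero_of_support_subset (hUc.inter isClosed_closedBall)
        (hsub.trans (subset_inter hbU hbw)) hz, norm_zero]
      positivity
  have key := hC g w _ L hgs (hsub.trans hbw) hgb
  have hint : ∫ z, Complex.exp (Complex.I * F z) * b z =
      Complex.exp ((F z₀ - L z₀ : ℝ) * Complex.I) * ∫ z, Complex.exp (Complex.I * L z) * g z := by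
    rw [← integral_const_mul]
    congr 1
    funext z
    simp only [hg, hQ, ← mul_assoc, ← Complex.exp_add]
    congr 2
    push_cast
    ring
  rw [hint, norm_mul, Complex.norm_exp_ofReal_mul_I, one_mul]
  refine key.trans (le_of_eq ?_)
  rw [mul_pow]
  ring

/-- Superposition of the unit scale bounds. -/
lemma exists_norm_integral_le (E : Type*) [NormedAddCommGroup E] [InnerProductSpace ℝ E]
    [FiniteDimensional ℝ E] [MeasurableSpace E] [BorelSpace E] (N : ℕ) (hN : 2 ≤ N) :
    ∃ C : ℝ, 0 ≤ C ∧ ∀ (F : E → ℝ) (b : E → ℂ) (U : Set E) (M B : ℝ) (H : E → ℝ),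
      ContDiff ℝ (⊤ : ℕ∞) F → ContDiff ℝ (⊤ : ℕ∞) b → Convex ℝ U → IsClosed U → 1 ≤ M → 0 ≤ B →
      (∀ z ∈ U, ∀ k, 2 ≤ k → k ≤ N → ‖iteratedFDeriv ℝ k F z‖ ≤ M) →
      (∀ z ∈ U, ∀ k ≤ N, ‖iteratedFDeriv ℝ k b z‖ ≤ B) →
      Function.support b ⊆ U → Integrable H → (∀ w, 0 ≤ H w) →
      (∀ w, ∀ z ∈ Function.support b, ‖z - w‖ ≤ 1 → 1 ≤ H w * (1 + ‖fderiv ℝ F z‖) ^ N) →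
      ‖∫ z, Complex.exp (Complex.I * F z) * b z‖ ≤ C * (M ^ N * B) * ∫ w, H w := by
  obtain ⟨C, hC0, hC⟩ := exists_unit_scale_bound E N hN
  let f : ContDiffBump (0 : E) := ⟨1 / 2, 1, by norm_num, by norm_num⟩
  set φ : E → ℂ := fun x => (f.normed volume x : ℂ) with hφ
  have hφs : ContDiff ℝ (⊤ : ℕ∞) φ :=
    Complex.ofRealCLM.contDiff.comp (f.contDiff_normed (μ := volume))
  have hφsupp : Function.support φ ⊆ ball 0 1 := by
    intro x hx
    have : x ∈ Function.support (f.normed volume) := fun h => hx (by simp [hφ, h])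
    rwa [f.support_normed_eq] at this
  have hφc : HasCompactSupport φ :=
    HasCompactSupport.of_support_subset_isCompact (isCompact_closedBall 0 1)
      (hφsupp.trans ball_subset_closedBall)
  have hφint : ∫ x, φ x = 1 := by
    rw [hφ, integral_complex_ofReal, f.integral_normed, Complex.ofReal_one]
  have hφi : Integrable φ := hφs.continuous.integrable_of_hasCompactSupport hφc
  obtain ⟨Cφ, hCφ0, hCφ⟩ := exists_iteratedFDeriv_bound hφs hφc N
  refine ⟨C * (2 ^ N * Cφ), by positivity,
    fun F b U M B H hF hb hU hUc hM hB hFM hbB hbU hH hH0 hHw => ?_⟩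
  set h : E → ℂ := fun z => Complex.exp (Complex.I * F z) * b z with hh
  have hRHS : 0 ≤ C * (2 ^ N * Cφ) * (M ^ N * B) * ∫ w, H w := by
    have := integral_nonneg (μ := volume) (f := H) hH0
    positivity
  by_cases hi : Integrable h
  swap
  · rw [integral_undef hi, norm_zero]
    exact hRHS
  have hconv := integral_convolution (μ := volume) (ν := volume) (ContinuousLinearMap.mul ℝ ℂ)
    hi hφi
  rw [hφint, ContinuousLinearMap.mul_apply', mul_one] at hconv
  rw [← hconv, ← integral_const_mul]
  refine norm_integral_le_of_norm_le (hH.const_mul _) (Filter.Eventually.of_forall fun w => ?_)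
  set bw : E → ℂ := fun z => b z * φ (w - z) with hbw
  have hφw : ContDiff ℝ (⊤ : ℕ∞) fun z => φ (w - z) := hφs.comp (contDiff_const.sub contDiff_id)
  have hcw : (MeasureTheory.convolution h φ (ContinuousLinearMap.mul ℝ ℂ) volume) w =
      ∫ z, Complex.exp (Complex.I * F z) * bw z := by
    rw [convolution_def]
    congr 1
    funext z
    simp only [ContinuousLinearMap.mul_apply', hh, hbw, mul_assoc]
  rw [hcw]
  have hbw1 : Function.support bw ⊆ Function.support b := Function.support_mul_subset_left _ _
  have hbw2 : Function.support bw ⊆ closedBall w 1 := by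
    intro z hz
    have := hφsupp (Function.support_mul_subset_right b (fun z => φ (w - z)) hz :
      φ (w - z) ≠ 0)
    rw [mem_ball_zero_iff] at this
    rw [mem_closedBall, dist_comm, dist_eq_norm]
    exact this.le
  obtain hem | ⟨z₀, hz₀⟩ := (Function.support bw).eq_empty_or_nonempty
  · rw [Function.support_eq_empty_iff] at hem
    simp only [hem, Pi.zero_apply, mul_zero, integral_zero, norm_zero]
    have := hH0 w
    positivity
  have hφwb : ∀ k ≤ N, ∀ z, ‖iteratedFDeriv ℝ k (fun z => φ (w - z)) z‖ ≤ Cφ := by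
    intro k hk z
    have h1 := norm_iteratedFDeriv_comp_affine_le hφs w (-ContinuousLinearMap.id ℝ E) k z
    have h2 : (fun z => φ (w + (-ContinuousLinearMap.id ℝ E) z)) = fun z => φ (w - z) := by
      funext z
      simp [sub_eq_add_neg]
    rw [h2, norm_neg] at h1
    refine h1.trans ?_
    calc _ ≤ Cφ * 1 ^ k := by
          gcongr
          · exact hCφ k hk _
          · exact ContinuousLinearMap.norm_id_le
      _ = Cφ := by simp
  have key := hC F bw U M (2 ^ N * (B * Cφ)) w z₀ hF (hb.mul hφw) hU hUc hM (by positivity) hFM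
    (fun z hz k hk => norm_iteratedFDeriv_mul_le_of_le hb hφw hk (hbB z hz)
      fun j hj => hφwb j hj z)
    (hbw1.trans hbU) hbw2 (hbU (hbw1 hz₀)) (hbw2 hz₀)
  have hone := hHw w z₀ (hbw1 hz₀) (by simpa [dist_eq_norm] using hbw2 hz₀)
  set I := ‖∫ z, Complex.exp (Complex.I * F z) * bw z‖
  calc I ≤ H w * (1 + ‖fderiv ℝ F z₀‖) ^ N * I := le_mul_of_one_le_left (norm_nonneg _) hone
    _ = H w * ((1 + ‖fderiv ℝ F z₀‖) ^ N * I) := mul_assoc _ _ _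
    _ ≤ H w * (C * (M ^ N * (2 ^ N * (B * Cφ)))) := mul_le_mul_of_nonneg_left key (hH0 w)
    _ = _ := by ring

end OscillatoryIntegrals

section LinearAlgebra

lemma repr_toLin_diagonal {E : Type*} [NormedAddCommGroup E] [InnerProductSpace ℝ E] {n : ℕ}
    (e : OrthonormalBasis (Fin n) ℝ E) (c : Fin n → ℝ) (z : E) (i : Fin n) :
    e.repr (Matrix.toLin e.toBasis e.toBasis (Matrix.diagonal c) z) i = c i * e.repr z i := by
  have h := Matrix.toLin_apply e.toBasis e.toBasis (Matrix.diagonal c) z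
  rw [← e.coe_toBasis_repr_apply, ← e.coe_toBasis_repr_apply, h]
  simp [Matrix.mulVec_diagonal]

/-- A linear change of variables bringing a nondegenerate symmetric operator, multiplied by a
large parameter, to an isometry. -/
lemma exists_normalizing_frame {E : Type*} [NormedAddCommGroup E] [InnerProductSpace ℝ E]
    [FiniteDimensional ℝ E] {T : E →ₗ[ℝ] E} (hT : T.IsSymmetric) {μ lam : ℝ} (hμ : 0 < μ)
    (hlam : 0 < lam) (hTμ : ∀ v, μ * ‖v‖ ≤ ‖T v‖) :
    ∃ (A : E →L[ℝ] E) (S : E → E), (∀ z, ‖S z‖ = ‖z‖) ∧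
      (∀ z v, lam * inner ℝ (T (A z)) (A v) = inner ℝ (S z) v) ∧
      ‖A‖ ≤ (√(lam * μ))⁻¹ ∧
      |A.det| = lam ^ (-(Module.finrank ℝ E : ℝ) / 2) * |LinearMap.det T| ^ (-(1 : ℝ) / 2) := by
  set e := hT.eigenvectorBasis rfl
  set κ := hT.eigenvalues rfl
  have hTe : ∀ x i, e.repr (T x) i = κ i * e.repr x i := fun x i => by
    simpa using hT.eigenvectorBasis_apply_self_apply rfl x i
  have hκ : ∀ i, μ ≤ |κ i| := by
    intro i
    have h1 := hTμ (e i)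
    have h2 : T (e i) = κ i • e i := hT.apply_eigenvectorBasis rfl i
    rw [h2, norm_smul, e.norm_eq_one, mul_one, mul_one] at h1
    exact h1
  have hκ0 : ∀ i, 0 < |κ i| := fun i => hμ.trans_le (hκ i)
  set c : Fin (Module.finrank ℝ E) → ℝ := fun i => (√(lam * |κ i|))⁻¹ with hc
  have hc2 : ∀ i, c i ^ 2 = (lam * |κ i|)⁻¹ := fun i => by
    rw [hc]
    simp only [inv_pow]
    rw [Real.sq_sqrt (mul_pos hlam (hκ0 i)).le]
  have hsq : ∀ x : E, ‖x‖ ^ 2 = ∑ i, e.repr x i ^ 2 := fun x => by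
    rw [← e.repr.norm_map, EuclideanSpace.norm_sq_eq]
    simp
  have hin : ∀ x y : E, inner ℝ x y = ∑ i, e.repr x i * e.repr y i := fun x y => by
    rw [← e.repr.inner_map_map, PiLp.inner_apply]
    simp [mul_comm]
  set A := Matrix.toLin e.toBasis e.toBasis (Matrix.diagonal c) with hA
  set S := Matrix.toLin e.toBasis e.toBasis (Matrix.diagonal fun i => κ i / |κ i|) with hS
  refine ⟨LinearMap.toContinuousLinearMap A, S, fun z => ?_, fun z v => ?_, ?_, ?_⟩
  · rw [← sq_eq_sq₀ (norm_nonneg _) (norm_nonneg _), hsq, hsq]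
    refine Finset.sum_congr rfl fun i _ => ?_
    rw [hS, repr_toLin_diagonal, mul_pow, div_pow, sq_abs, div_self, one_mul]
    exact pow_ne_zero 2 (abs_pos.mp (hκ0 i))
  · rw [hin, hin, Finset.mul_sum]
    refine Finset.sum_congr rfl fun i _ => ?_
    rw [hTe]
    simp only [LinearMap.coe_toContinuousLinearMap', hA, hS, repr_toLin_diagonal]
    have h := hc2 i
    have h3 := (hκ0 i).ne'
    calc lam * (κ i * (c i * e.repr z i) * (c i * e.repr v i))
        = lam * c i ^ 2 * κ i * e.repr z i * e.repr v i := by ring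
      _ = _ := by rw [h]; field_simp
  · refine ContinuousLinearMap.opNorm_le_bound _ (by positivity) fun z => ?_
    rw [← sq_le_sq₀ (norm_nonneg _) (by positivity), mul_pow, inv_pow,
      Real.sq_sqrt (by positivity), hsq, hsq, Finset.mul_sum]
    refine Finset.sum_le_sum fun i _ => ?_
    simp only [LinearMap.coe_toContinuousLinearMap', hA, repr_toLin_diagonal]
    rw [mul_pow, hc2]
    gcongr
    exact hκ i
  · have h1 : (LinearMap.toContinuousLinearMap A).det = ∏ i, c i := by
      change LinearMap.det A = _
      rw [hA, LinearMap.det_toLin, Matrix.det_diagonal]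
    have h2 : LinearMap.det T = ∏ i, κ i := by
      simpa using hT.det_eq_prod_eigenvalues rfl
    have h3 : ∀ i, c i = lam ^ (-(1 : ℝ) / 2) * |κ i| ^ (-(1 : ℝ) / 2) := fun i => by
      rw [← Real.mul_rpow hlam.le (abs_nonneg _)]
      simp only [hc]
      rw [Real.sqrt_eq_rpow, ← Real.rpow_neg (by positivity)]
      norm_num
    rw [h1, h2, Finset.abs_prod, Finset.abs_prod,
      ← Real.finsetProd_rpow _ _ fun i _ => abs_nonneg _]
    have h4 : ∀ i, |c i| = lam ^ (-(1 : ℝ) / 2) * |κ i| ^ (-(1 : ℝ) / 2) := fun i => by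
      rw [h3, abs_of_nonneg (by positivity)]
    simp only [h4, Finset.prod_mul_distrib, Finset.prod_const, Finset.card_univ, Fintype.card_fin]
    rw [← Real.rpow_natCast, ← Real.rpow_mul hlam.le]
    congr 2
    ring

end LinearAlgebra

section Gap

lemma le_norm_fderiv_apply_of_le_norm_sub {E F : Type*} [NormedAddCommGroup E] [NormedSpace ℝ E]
    [NormedAddCommGroup F] [NormedSpace ℝ F] {G : E → F} (hG : ContDiff ℝ 1 G) {s : Set E}
    (hs : IsOpen s) {μ : ℝ} (hgap : ∀ x ∈ s, ∀ y ∈ s, μ * ‖x - y‖ ≤ ‖G x - G y‖) {x : E}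
    (hx : x ∈ closure s) (v : E) : μ * ‖v‖ ≤ ‖fderiv ℝ G x v‖ := by
  have hcl : IsClosed {x | μ * ‖v‖ ≤ ‖fderiv ℝ G x v‖} :=
    isClosed_le continuous_const
      (((hG.continuous_fderiv one_ne_zero).clm_apply continuous_const).norm)
  refine hcl.closure_subset_iff.mpr (fun y hy => ?_) hx
  have hline : HasDerivAt (fun t : ℝ => y + t • v) v 0 := by
    simpa using ((hasDerivAt_id (0 : ℝ)).smul_const v).const_add y
  have hd : HasDerivAt (fun t : ℝ => G (y + t • v)) (fderiv ℝ G y v) 0 := by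
    have h0 : HasFDerivAt G (fderiv ℝ G y) (y + (0 : ℝ) • v) := by
      simpa using (hG.differentiable one_ne_zero y).hasFDerivAt
    exact h0.comp_hasDerivAt 0 hline
  refine ge_of_tendsto hd.tendsto_slope_zero.norm ?_
  have hmem : ∀ᶠ t : ℝ in nhds 0, y + t • v ∈ s :=
    hline.continuousAt.eventually_mem (by simpa using hs.mem_nhds hy)
  filter_upwards [nhdsWithin_le_nhds hmem, self_mem_nhdsWithin] with t ht ht0
  have ht0 : 0 < |t| := abs_pos.mpr ht0
  have := hgap _ ht _ hy
  rw [add_sub_cancel_left, norm_smul, Real.norm_eq_abs] at this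
  rw [zero_add, zero_smul, add_zero, norm_smul, norm_inv, Real.norm_eq_abs,
    le_inv_mul_iff₀ ht0]
  linarith

end Gap

section SupNorms

variable {d : ℕ} {F : Type*} [NormedAddCommGroup F] [NormedSpace ℝ F]

lemma supDeriv_nonneg (k : ℕ) (f : Euc d → F) (s : Set (Euc d)) : 0 ≤ supDeriv k f s :=
  Real.sSup_nonneg (by rintro _ ⟨x, _, rfl⟩; exact norm_nonneg _)

lemma norm_iteratedFDeriv_le_supDeriv {f : Euc d → F} (hf : ContDiff ℝ (⊤ : ℕ∞) f) (k : ℕ)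
    {x : Euc d} (hx : x ∈ closedBall (0 : Euc d) 1) :
    ‖iteratedFDeriv ℝ k f x‖ ≤ supDeriv k f (ball 0 1) := by
  have hc : Continuous fun x => ‖iteratedFDeriv ℝ k f x‖ :=
    (hf.continuous_iteratedFDeriv (by exact_mod_cast le_top)).norm
  have hbdd : BddAbove ((fun x => ‖iteratedFDeriv ℝ k f x‖) '' ball 0 1) :=
    ((isCompact_closedBall (0 : Euc d) 1).bddAbove_image hc.continuousOn).mono
      (image_mono ball_subset_closedBall)
  rw [← closure_ball (0 : Euc d) one_ne_zero] at hx
  exact (isClosed_le hc continuous_const).closure_subset_iff.mpr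
    (fun y hy => le_csSup hbdd (mem_image_of_mem _ hy)) hx

lemma supDeriv_le_CnormNat (f : Euc d → F) (s : Set (Euc d)) {k N : ℕ} (hk : k ≤ N) :
    supDeriv k f s ≤ CnormNat N f s :=
  Finset.single_le_sum (f := fun k => supDeriv k f s) (fun j _ => supDeriv_nonneg j f s)
    (Finset.mem_range.mpr (by omega))

lemma supDeriv_le_Pnorm (f : Euc d → ℝ) (s : Set (Euc d)) {k N : ℕ} (h2 : 2 ≤ k) (hk : k ≤ N) :
    supDeriv k f s ≤ Pnorm N f s :=
  Finset.single_le_sum (f := fun k => supDeriv k f s) (fun j _ => supDeriv_nonneg j f s)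
    (Finset.mem_Icc.mpr ⟨h2, hk⟩)

lemma Pnorm_mono (f : Euc d → ℝ) (s : Set (Euc d)) {m n : ℕ} (h : m ≤ n) :
    Pnorm m f s ≤ Pnorm n f s :=
  Finset.sum_le_sum_of_subset_of_nonneg (Finset.Icc_subset_Icc_right h)
    fun j _ _ => supDeriv_nonneg j f s

end SupNorms

section Localization

lemma integral_comp_affine {E G : Type*} [NormedAddCommGroup E] [NormedSpace ℝ E]
    [FiniteDimensional ℝ E] [MeasurableSpace E] [BorelSpace E] [NormedAddCommGroup G]
    [NormedSpace ℝ G] (μ : Measure E) [μ.IsAddHaarMeasure] (p : E) {A : E →L[ℝ] E} (hA : A.det ≠ 0)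
    (f : E → G) : ∫ x, f x ∂μ = |A.det| • ∫ z, f (p + A z) ∂μ := by
  have hbij : Function.Bijective A := by
    have : IsUnit (LinearMap.det (A : E →ₗ[ℝ] E)) := isUnit_iff_ne_zero.mpr hA
    exact (Module.End.isUnit_iff _).mp ((LinearMap.isUnit_iff_isUnit_det _).mpr this)
  have hbij' : Function.Bijective fun z => p + A z := (Equiv.addLeft p).bijective.comp hbij
  have h := integral_image_eq_integral_abs_det_fderiv_smul μ MeasurableSet.univ
    (f := fun z => p + A z) (f' := fun _ => A)
    (fun x _ => (A.hasFDerivAt.const_add p).hasFDerivWithinAt) hbij'.injective.injOn f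
  rw [image_univ, hbij'.surjective.range_eq, setIntegral_univ, setIntegral_univ,
    integral_smul] at h
  exact h

/-- The part of an oscillatory integral singled out by a cutoff at scale `r`, estimated in the
coordinates `x = p + A z`. -/
lemma exists_localized_bound (d N : ℕ) (hN : 2 ≤ N) {η : Euc d → ℂ}
    (hη : ContDiff ℝ (⊤ : ℕ∞) η) {Cη : ℝ} (hηb : ∀ k ≤ N, ∀ z, ‖iteratedFDeriv ℝ k η z‖ ≤ Cη) :
    ∃ C : ℝ, 0 ≤ C ∧ ∀ (lam : ℝ) (Φ : Euc d → ℝ) (ψ : Euc d → ℂ) (p : Euc d) (r M : ℝ)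
      (A : Euc d →L[ℝ] Euc d) (V : Set (Euc d)) (H : Euc d → ℝ),
      ContDiff ℝ (⊤ : ℕ∞) Φ → ContDiff ℝ (⊤ : ℕ∞) ψ → Function.support ψ ⊆ ball 0 1 →
      0 < r → 1 ≤ M → A.det ≠ 0 → ‖A‖ ≤ 1 → ‖A‖ ≤ 4 * r →
      Convex ℝ V → IsClosed V → V ⊆ closedBall 0 1 →
      (∀ x ∈ ball (0 : Euc d) 1, η (r⁻¹ • (x - p)) ≠ 0 → x ∈ V) →
      (∀ z, p + A z ∈ V → ∀ k, 2 ≤ k → k ≤ N →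
        ‖iteratedFDeriv ℝ k (fun z => lam * Φ (p + A z)) z‖ ≤ M) →
      Integrable H → (∀ w, 0 ≤ H w) →
      (∀ w z, p + A z ∈ V → η (r⁻¹ • A z) ≠ 0 → ‖z - w‖ ≤ 1 →
        1 ≤ H w * (1 + ‖fderiv ℝ (fun z => lam * Φ (p + A z)) z‖) ^ N) →
      ‖oscInt lam Φ (fun x => ψ x * η (r⁻¹ • (x - p)))‖ ≤
        |A.det| * (C * (M ^ N * CnormNat N ψ (ball 0 1)) * ∫ w, H w) := by
  obtain ⟨C, hC0, hC⟩ := exists_norm_integral_le (Euc d) N hN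
  have hCη0 : 0 ≤ Cη := (norm_nonneg _).trans (hηb 0 (Nat.zero_le _) 0)
  refine ⟨C * (2 ^ N * (4 ^ N * Cη)), by positivity,
    fun lam Φ ψ p r M A V H hΦ hψ hsupp hr hM hA hA1 hAr hV hVc hVb hηV hΦM hH hH0 hHw => ?_⟩
  set F : Euc d → ℝ := fun z => lam * Φ (p + A z) with hF
  set b : Euc d → ℂ := fun z => ψ (p + A z) * η (r⁻¹ • A z) with hb
  set Nψ := CnormNat N ψ (ball 0 1) with hNψ
  have hNψ0 : 0 ≤ Nψ := Finset.sum_nonneg fun k _ => supDeriv_nonneg k _ _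
  have hFs : ContDiff ℝ (⊤ : ℕ∞) F := contDiff_const.mul (contDiff_comp_affine hΦ p A)
  have hψs := contDiff_comp_affine hψ p A
  have hηs : ContDiff ℝ (⊤ : ℕ∞) fun z => η (0 + (r⁻¹ • A) z) := contDiff_comp_affine hη 0 (r⁻¹ • A)
  have hηe : (fun z => η (0 + (r⁻¹ • A) z)) = fun z => η (r⁻¹ • A z) := by
    funext z
    simp
  set U : Set (Euc d) := (fun z => p + A z) ⁻¹' V with hU
  have hbU : Function.support b ⊆ U := by
    intro z hz
    refine hηV _ (hsupp (left_ne_zero_of_mul hz)) ?_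
    rw [add_sub_cancel_left]
    exact right_ne_zero_of_mul hz
  have hUconv : Convex ℝ U := by
    have := (hV.translate_preimage_right p).linear_preimage (A : Euc d →ₗ[ℝ] Euc d)
    exact this
  have hUc : IsClosed U := hVc.preimage (continuous_const.add A.continuous)
  have hbB : ∀ z ∈ U, ∀ k ≤ N, ‖iteratedFDeriv ℝ k b z‖ ≤ 2 ^ N * (Nψ * (4 ^ N * Cη)) := by
    intro z hz k hk
    have hηs' := hηs
    rw [hηe] at hηs'
    refine norm_iteratedFDeriv_mul_le_of_le hψs hηs' hk (fun j hj => ?_) fun j hj => ?_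
    · calc _ ≤ ‖iteratedFDeriv ℝ j ψ (p + A z)‖ * ‖A‖ ^ j :=
            norm_iteratedFDeriv_comp_affine_le hψ p A j z
        _ ≤ Nψ * 1 := by
            gcongr
            · exact (norm_iteratedFDeriv_le_supDeriv hψ j (hVb hz)).trans
                (supDeriv_le_CnormNat _ _ hj)
            · exact pow_le_one₀ (norm_nonneg _) hA1
        _ = Nψ := mul_one _
    · have h1 := norm_iteratedFDeriv_comp_affine_le hη 0 (r⁻¹ • A) j z
      rw [hηe] at h1
      have h2 : ‖r⁻¹ • A‖ ≤ 4 := by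
        rw [norm_smul, norm_inv, Real.norm_of_nonneg hr.le, inv_mul_le_iff₀ hr]
        linarith
      calc _ ≤ _ := h1
        _ ≤ Cη * 4 ^ N := by
            gcongr
            · exact hηb j hj _
            · calc ‖r⁻¹ • A‖ ^ j ≤ 4 ^ j := by gcongr
                _ ≤ 4 ^ N := by
                  gcongr
                  norm_num
        _ = _ := mul_comm _ _
  have hbs : ContDiff ℝ (⊤ : ℕ∞) b := by
    rw [hηe] at hηs
    exact hψs.mul hηs
  have key := hC F b U M (2 ^ N * (Nψ * (4 ^ N * Cη))) H hFs hbs hUconv hUc hM (by positivity)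
    hΦM hbB hbU hH hH0 fun w z hz hzw => hHw w z (hbU hz) (right_ne_zero_of_mul hz) hzw
  rw [oscInt, integral_comp_affine volume p hA, norm_smul, Real.norm_eq_abs, abs_abs]
  have hint : (∫ z, Complex.exp (Complex.I * lam * (Φ (p + A z) : ℂ)) *
      (ψ (p + A z) * η (r⁻¹ • (p + A z - p)))) = ∫ z, Complex.exp (Complex.I * F z) * b z := by
    congr 1
    funext z
    simp only [hF, hb, add_sub_cancel_left, Complex.ofReal_mul, mul_assoc]
  rw [hint]
  refine mul_le_mul_of_nonneg_left (key.trans (le_of_eq ?_)) (abs_nonneg _)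
  ring

/-- Derivatives of order at least three of the rescaled phase. -/
lemma norm_iteratedFDeriv_phase_le {d N : ℕ} {lam μ : ℝ} {Φ : Euc d → ℝ}
    (hΦ : ContDiff ℝ (⊤ : ℕ∞) Φ) (hlam : 0 < lam) (hμ : 0 < μ) {p : Euc d}
    {A : Euc d →L[ℝ] Euc d} (hA1 : ‖A‖ ≤ 1) (hA : ‖A‖ ≤ (√(lam * μ))⁻¹)
    (hP0 : 0 < Pnorm 3 Φ (ball 0 1)) (hP : (√(lam * μ))⁻¹ * Pnorm 3 Φ (ball 0 1) ≤ μ)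
    {z : Euc d} (hz : p + A z ∈ closedBall (0 : Euc d) 1) {k : ℕ} (hk : 3 ≤ k) (hkN : k ≤ N) :
    ‖iteratedFDeriv ℝ k (fun z => lam * Φ (p + A z)) z‖ ≤
      Pnorm N Φ (ball 0 1) / Pnorm 3 Φ (ball 0 1) := by
  have hlΦ : ContDiff ℝ (⊤ : ℕ∞) (fun x => lam * Φ x) := contDiff_const.mul hΦ
  have h1 := norm_iteratedFDeriv_comp_affine_le hlΦ p A k z
  have h2 : ‖iteratedFDeriv ℝ k (fun x => lam * Φ x) (p + A z)‖ ≤ lam * Pnorm N Φ (ball 0 1) := by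
    have h3 := iteratedFDeriv_const_smul_apply (𝕜 := ℝ) (i := k) (a := lam) (x := p + A z)
      (hΦ.contDiffAt.of_le (by exact_mod_cast le_top))
    change ‖iteratedFDeriv ℝ k (lam • Φ) (p + A z)‖ ≤ _
    rw [h3, norm_smul, Real.norm_of_nonneg hlam.le]
    gcongr
    exact (norm_iteratedFDeriv_le_supDeriv hΦ k hz).trans (supDeriv_le_Pnorm _ _ (by omega) hkN)
  set a := (√(lam * μ))⁻¹ with ha
  have ha0 : 0 ≤ a := by positivity
  have ha2 : a ^ 2 * (lam * μ) = 1 := by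
    rw [ha, inv_pow, Real.sq_sqrt (by positivity), inv_mul_cancel₀ (by positivity)]
  have hPN0 : 0 ≤ Pnorm N Φ (ball 0 1) := Finset.sum_nonneg fun k _ => supDeriv_nonneg k _ _
  calc _ ≤ _ := h1
    _ ≤ lam * Pnorm N Φ (ball 0 1) * a ^ 3 := by
        gcongr
        calc ‖A‖ ^ k ≤ ‖A‖ ^ 3 := pow_le_pow_of_le_one (norm_nonneg _) hA1 hk
          _ ≤ a ^ 3 := by gcongr
    _ ≤ _ := by
        rw [le_div_iff₀ hP0]
        calc lam * Pnorm N Φ (ball 0 1) * a ^ 3 * Pnorm 3 Φ (ball 0 1)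
            = Pnorm N Φ (ball 0 1) * (lam * a ^ 2 * (a * Pnorm 3 Φ (ball 0 1))) := by ring
          _ ≤ Pnorm N Φ (ball 0 1) * (lam * a ^ 2 * μ) := by gcongr
          _ = Pnorm N Φ (ball 0 1) * (a ^ 2 * (lam * μ)) := by ring
          _ = _ := by rw [ha2, mul_one]

lemma fderiv_phase {d : ℕ} {Φ : Euc d → ℝ} (hΦ : ContDiff ℝ (⊤ : ℕ∞) Φ) (lam : ℝ) (p : Euc d)
    (A : Euc d →L[ℝ] Euc d) (z : Euc d) :
    fderiv ℝ (fun z => lam * Φ (p + A z)) z = lam • (fderiv ℝ Φ (p + A z)).comp A := by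
  have h := (hΦ.differentiable (by simp) (p + A z)).hasFDerivAt.comp z (A.hasFDerivAt.const_add p)
  exact (h.const_mul lam).fderiv

end Localization

section StationaryPhase

lemma det_eq_det_Hess_of_inner_eq {d : ℕ} {Φ : Euc d → ℝ} (x : Euc d)
    {T : Euc d →ₗ[ℝ] Euc d}
    (hT : ∀ u v, inner ℝ (T u) v = fderiv ℝ (fderiv ℝ Φ) x u v) :
    LinearMap.det T = (Hess Φ x).det := by
  rw [← LinearMap.det_toMatrix (EuclideanSpace.basisFun (Fin d) ℝ).toBasis, ← Matrix.det_transpose]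
  congr 1
  ext i j
  rw [Matrix.transpose_apply, LinearMap.toMatrix_apply, Hess, Matrix.of_apply,
    iteratedFDeriv_two_apply]
  simp only [Matrix.cons_val_zero, Matrix.cons_val_one]
  rw [← hT, EuclideanSpace.inner_single_right]
  simp

lemma two_mul_max_one_pow_le {R : ℝ} (hR : 0 ≤ R) (N : ℕ) :
    (2 * max 1 R) ^ N ≤ 2 ^ N * (1 + R ^ N) := by
  rw [mul_pow]
  gcongr
  rcases max_cases 1 R with ⟨h, _⟩ | ⟨h, _⟩ <;> rw [h]
  · rw [one_pow]
    linarith [pow_nonneg hR N]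
  · linarith

/-- Contribution of the ball of radius comparable to `μ / 𝒫₃` around the critical point. -/
lemma exists_near_bound (d N : ℕ) (hN : 2 ≤ N) (hdN : d < N) {η : Euc d → ℂ}
    (hη : ContDiff ℝ (⊤ : ℕ∞) η) {Cη : ℝ} (hηb : ∀ k ≤ N, ∀ z, ‖iteratedFDeriv ℝ k η z‖ ≤ Cη)
    (hηs : ∀ y, η y ≠ 0 → ‖y‖ ≤ 2) :
    ∃ C : ℝ, 0 ≤ C ∧ ∀ (lam : ℝ) (Φ : Euc d → ℝ) (ψ : Euc d → ℂ) (μ : ℝ) (xc : Euc d),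
      ContDiff ℝ (⊤ : ℕ∞) Φ → ContDiff ℝ (⊤ : ℕ∞) ψ → Function.support ψ ⊆ ball 0 1 →
      0 < lam → 0 < μ → xc ∈ closedBall (0 : Euc d) 1 → fderiv ℝ Φ xc = 0 →
      (∀ v, μ * ‖v‖ ≤ ‖fderiv ℝ (fderiv ℝ Φ) xc v‖) → μ ≤ Pnorm 3 Φ (ball 0 1) →
      (√(lam * μ))⁻¹ * Pnorm 3 Φ (ball 0 1) ≤ μ →
      ‖oscInt lam Φ (fun x => ψ x * η ((μ / (4 * Pnorm 3 Φ (ball 0 1)))⁻¹ • (x - xc)))‖ ≤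
        C * ((1 + (Pnorm N Φ (ball 0 1) / Pnorm 3 Φ (ball 0 1)) ^ N) * CnormNat N ψ (ball 0 1)) *
          (|(Hess Φ xc).det| ^ (-(1 : ℝ) / 2) * lam ^ (-(d : ℝ) / 2)) := by
  obtain ⟨C, hC0, hC⟩ := exists_localized_bound d N hN hη hηb
  set H : Euc d → ℝ := fun w => 2 ^ N * (1 + ‖w‖) ^ (-(N : ℝ)) with hH
  have hHi : Integrable H :=
    (integrable_one_add_norm (by simpa using hdN)).const_mul _
  have hH0 : ∀ w, 0 ≤ H w := fun w => by positivity
  have hHI : 0 ≤ ∫ w, H w := integral_nonneg hH0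
  refine ⟨C * 2 ^ N * ∫ w, H w, by positivity,
    fun lam Φ ψ μ xc hΦ hψ hsupp hlam hμ hxc hcrit hgap hμP haP => ?_⟩
  set P := Pnorm 3 Φ (ball 0 1) with hP
  set R := Pnorm N Φ (ball 0 1) / P with hR
  set r := μ / (4 * P) with hr
  set a := (√(lam * μ))⁻¹ with ha
  have hP0 : 0 < P := hμ.trans_le hμP
  have hr0 : 0 < r := by positivity
  have hPN0 : 0 ≤ Pnorm N Φ (ball 0 1) := Finset.sum_nonneg fun k _ => supDeriv_nonneg k _ _
  have hCψ : 0 ≤ CnormNat N ψ (ball 0 1) := Finset.sum_nonneg fun k _ => supDeriv_nonneg k _ _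
  have hR0 : 0 ≤ R := by positivity
  have hrP : P * (2 * r) = μ / 2 := by
    rw [hr]
    field_simp
    norm_num
  have ha0 : 0 < a := by positivity
  have ha2 : lam * μ * a ^ 2 = 1 := by
    rw [ha, inv_pow, Real.sq_sqrt (by positivity), mul_inv_cancel₀ (by positivity)]
  have ha4 : a ≤ 4 * r := by
    rw [hr, mul_div_assoc', mul_div_mul_left _ _ (by norm_num), le_div_iff₀ hP0]
    exact haP
  have ha1 : a ≤ 1 := by
    have : a * P ≤ 1 * P := by linarith
    exact le_of_mul_le_mul_right this hP0
  set G := fderiv ℝ Φ with hG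
  set Bc := fderiv ℝ G xc with hBc
  have hGs : ContDiff ℝ (⊤ : ℕ∞) G := hΦ.fderiv_right (by simp)
  set T : Euc d →ₗ[ℝ] Euc d :=
    { toFun := fun u => (InnerProductSpace.toDual ℝ (Euc d)).symm (Bc u)
      map_add' := fun u v => by simp
      map_smul' := fun c u => by simp } with hT
  have hTin : ∀ u v, inner ℝ (T u) v = Bc u v := fun u v => by
    simp [hT, InnerProductSpace.toDual_symm_apply]
  have hTsymm : T.IsSymmetric := fun u v => by
    rw [real_inner_comm (T v) u, hTin, hTin]
    exact ((contDiff_infty.mp hΦ 2).contDiffAt (x := xc)).isSymmSndFDerivAt (by simp) u v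
  have hTn : ∀ v, ‖T v‖ = ‖Bc v‖ := fun v => by simp [hT]
  obtain ⟨A, S, hS, hAS, hAn, hAdet⟩ :=
    exists_normalizing_frame hTsymm hμ hlam fun v => (hTn v).symm ▸ hgap v
  rw [det_eq_det_Hess_of_inner_eq xc hTin, finrank_euclideanSpace_fin] at hAdet
  have hTdet : (Hess Φ xc).det ≠ 0 := by
    rw [← det_eq_det_Hess_of_inner_eq xc hTin]
    refine (LinearEquiv.isUnit_det' (LinearEquiv.ofInjectiveEndo T ?_)).ne_zero
    rw [injective_iff_map_eq_zero]
    intro v hv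
    have := hgap v
    rw [← hTn, hv, norm_zero] at this
    exact norm_le_zero_iff.mp (nonpos_of_mul_nonpos_right this hμ)
  have hAdet0 : A.det ≠ 0 := by
    rw [← abs_pos, hAdet]
    have := abs_pos.mpr hTdet
    positivity
  set V : Set (Euc d) := closedBall xc (2 * r) ∩ closedBall 0 1 with hV
  have hVconv : Convex ℝ V := (convex_closedBall _ _).inter (convex_closedBall _ _)
  have hxcV : xc ∈ V := ⟨mem_closedBall_self (by positivity), hxc⟩
  have hBlip : ∀ x ∈ V, ‖fderiv ℝ G x - Bc‖ ≤ μ / 2 := by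
    intro x hx
    have hG' : ContDiff ℝ (⊤ : ℕ∞) (fderiv ℝ G) := hGs.fderiv_right (by simp)
    have h := Convex.norm_image_sub_le_of_norm_fderiv_le (𝕜 := ℝ) (f := fderiv ℝ G)
      (s := closedBall (0 : Euc d) 1) (C := P) (x := xc) (y := x)
      (fun y _ => hG'.differentiable (by simp) y)
      (fun y hy => by
        rw [norm_fderiv_fderiv, hG, norm_iteratedFDeriv_fderiv]
        exact (norm_iteratedFDeriv_le_supDeriv hΦ 3 hy).trans
          (supDeriv_le_Pnorm _ _ (by norm_num) le_rfl))
      (convex_closedBall _ _) hxc hx.2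
    rw [← hrP]
    refine h.trans ?_
    gcongr
    simpa [dist_eq_norm] using hx.1
  have hGlin : ∀ x ∈ V, ‖G x - Bc (x - xc)‖ ≤ μ / 2 * ‖x - xc‖ := by
    intro x hx
    have h := Convex.norm_image_sub_le_of_norm_hasFDerivWithin_le (𝕜 := ℝ)
      (f := fun y => G y - Bc y) (f' := fun y => fderiv ℝ G y - Bc) (s := V) (C := μ / 2)
      (x := xc) (y := x)
      (fun y _ => ((hGs.differentiable (by simp) y).hasFDerivAt.sub
        Bc.hasFDerivAt).hasFDerivWithinAt) hBlip hVconv hxcV hx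
    have h1 : G x - Bc x - (G xc - Bc xc) = G x - Bc (x - xc) := by
      rw [hcrit, map_sub]
      abel
    rwa [h1] at h
  have hAA : ∀ u v, lam * (μ / 2 * ‖A u‖ * ‖A v‖) ≤ 1 / 2 * (‖u‖ * ‖v‖) := by
    intro u v
    calc lam * (μ / 2 * ‖A u‖ * ‖A v‖) ≤ lam * (μ / 2 * (a * ‖u‖) * (a * ‖v‖)) := by
          gcongr <;> exact A.le_of_opNorm_le hAn _
      _ = lam * μ * a ^ 2 * (1 / 2 * (‖u‖ * ‖v‖)) := by ring
      _ = _ := by rw [ha2, one_mul]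
  have hASB : ∀ u v, lam * Bc (A u) (A v) = inner ℝ (S u) v := fun u v => by rw [← hAS, hTin]
  have hgrad : ∀ z, xc + A z ∈ V → ‖z‖ / 2 ≤ ‖fderiv ℝ (fun z => lam * Φ (xc + A z)) z‖ := by
    intro z hz
    rw [fderiv_phase hΦ]
    set L := lam • (G (xc + A z)).comp A with hL
    have h1 := hGlin _ hz
    rw [add_sub_cancel_left] at h1
    have h2 : L (S z) = inner ℝ (S z) (S z) + lam * (G (xc + A z) - Bc (A z)) (A (S z)) := by
      rw [← hASB]
      simp [hL]
      ring
    have h3 : |(G (xc + A z) - Bc (A z)) (A (S z))| ≤ μ / 2 * ‖A z‖ * ‖A (S z)‖ := by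
      rw [← Real.norm_eq_abs]
      exact ContinuousLinearMap.le_of_opNorm_le _ h1 _
    have h4 := hAA z (S z)
    have h5 : L (S z) ≤ ‖L‖ * ‖z‖ := by
      rw [← hS z]
      exact (le_abs_self _).trans (L.le_opNorm (S z))
    have h6 : lam * -(μ / 2 * ‖A z‖ * ‖A (S z)‖) ≤
        lam * (G (xc + A z) - Bc (A z)) (A (S z)) := by
      gcongr
      exact (abs_le.mp h3).1
    rw [real_inner_self_eq_norm_sq] at h2
    rw [hS] at h2 h4
    obtain h0 | h0 := (norm_nonneg z).eq_or_lt
    · rw [← h0, zero_div]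
      exact norm_nonneg _
    · have : ‖z‖ / 2 * ‖z‖ ≤ ‖L‖ * ‖z‖ := by nlinarith
      exact le_of_mul_le_mul_right this h0
  have hhess : ∀ z, xc + A z ∈ V →
      ‖iteratedFDeriv ℝ 2 (fun z => lam * Φ (xc + A z)) z‖ ≤ 2 := by
    intro z hz
    have hlΦ : ContDiff ℝ (⊤ : ℕ∞) (lam • Φ) := contDiff_const.smul hΦ
    have hval : ∀ m : Fin 2 → Euc d, iteratedFDeriv ℝ 2 (fun z => lam * Φ (xc + A z)) z m =
        lam * fderiv ℝ G (xc + A z) (A (m 0)) (A (m 1)) := by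
      intro m
      have h1 := iteratedFDeriv_comp_affine hlΦ xc A 2 z
      change iteratedFDeriv ℝ 2 (fun z => (lam • Φ) (xc + A z)) z m = _
      rw [h1, iteratedFDeriv_const_smul_apply (contDiff_infty.mp hΦ 2).contDiffAt]
      rw [ContinuousMultilinearMap.compContinuousLinearMap_apply,
        smul_apply, iteratedFDeriv_two_apply, smul_eq_mul]
    refine ContinuousMultilinearMap.opNorm_le_bound (by norm_num) fun m => ?_
    rw [hval, Fin.prod_univ_two]
    have h1 : lam * fderiv ℝ G (xc + A z) (A (m 0)) (A (m 1)) = inner ℝ (S (m 0)) (m 1) +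
        lam * (fderiv ℝ G (xc + A z) - Bc) (A (m 0)) (A (m 1)) := by
      rw [← hASB]
      simp
      ring
    have h2 : |(fderiv ℝ G (xc + A z) - Bc) (A (m 0)) (A (m 1))| ≤
        μ / 2 * ‖A (m 0)‖ * ‖A (m 1)‖ := by
      rw [← Real.norm_eq_abs]
      exact ContinuousLinearMap.le_of_opNorm_le _
        (ContinuousLinearMap.le_of_opNorm_le _ (hBlip _ hz) _) _
    have h3 : |inner ℝ (S (m 0)) (m 1)| ≤ ‖m 0‖ * ‖m 1‖ := by
      simpa [hS] using abs_real_inner_le_norm (S (m 0)) (m 1)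
    rw [h1, Real.norm_eq_abs]
    calc _ ≤ _ := abs_add_le _ _
      _ ≤ ‖m 0‖ * ‖m 1‖ + lam * (μ / 2 * ‖A (m 0)‖ * ‖A (m 1)‖) := by
          rw [abs_mul lam, abs_of_pos hlam]
          gcongr
      _ ≤ ‖m 0‖ * ‖m 1‖ + 1 / 2 * (‖m 0‖ * ‖m 1‖) := by
          exact add_le_add_right (hAA _ _) _
      _ ≤ 2 * (‖m 0‖ * ‖m 1‖) := by
          have : 0 ≤ ‖m 0‖ * ‖m 1‖ := by positivity
          linarith
  have hmax : 1 ≤ max 1 R := le_max_left _ _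
  have key := hC lam Φ ψ xc r (2 * max 1 R) A V H hΦ hψ hsupp hr0 (by linarith) hAdet0
    (hAn.trans ha1) (hAn.trans ha4) hVconv (isClosed_closedBall.inter isClosed_closedBall)
    inter_subset_right
    (fun x hx hηx => ⟨by
      have h := hηs _ hηx
      rw [norm_smul, norm_inv, Real.norm_of_nonneg hr0.le, inv_mul_le_iff₀ hr0] at h
      rw [mem_closedBall, dist_eq_norm]
      linarith, ball_subset_closedBall hx⟩)
    (fun z hz k hk hkN => by
      obtain rfl | hk3 : k = 2 ∨ 3 ≤ k := by omega
      · exact (hhess z hz).trans (by linarith)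
      · refine (norm_iteratedFDeriv_phase_le hΦ hlam hμ (hAn.trans ha1) hAn hP0 haP hz.2 hk3
          hkN).trans ?_
        linarith [le_max_right 1 R])
    hHi hH0
    (fun w z hz _ hzw => by
      have h1 := hgrad z hz
      have h2 : ‖w‖ ≤ ‖z‖ + 1 := by
        have := norm_sub_norm_le w z
        rw [norm_sub_rev] at this
        linarith
      have h3 : (1 + ‖w‖) / 2 ≤ 1 + ‖fderiv ℝ (fun z => lam * Φ (xc + A z)) z‖ := by linarith
      have h4 : 0 < 1 + ‖w‖ := by positivity
      calc (1 : ℝ) = H w * ((1 + ‖w‖) / 2) ^ N := by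
            rw [hH]
            simp only
            rw [Real.rpow_neg h4.le, Real.rpow_natCast, div_pow]
            field_simp
        _ ≤ _ := by
            have := hH0 w
            gcongr)
  refine key.trans ?_
  rw [hAdet]
  have hM := two_mul_max_one_pow_le hR0 N
  calc _ ≤ lam ^ (-(d : ℝ) / 2) * |(Hess Φ xc).det| ^ (-(1 : ℝ) / 2) *
        (C * (2 ^ N * (1 + R ^ N) * CnormNat N ψ (ball 0 1)) * ∫ w, H w) := by gcongr
    _ = _ := by ring

/-- Contribution of the complement of a ball of radius comparable to `μ / 𝒫₃` around the critical
point. -/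
lemma exists_far_bound (d N : ℕ) (hN : 2 ≤ N) {η : Euc d → ℂ}
    (hη : ContDiff ℝ (⊤ : ℕ∞) η) {Cη : ℝ} (hηb : ∀ k ≤ N, ∀ z, ‖iteratedFDeriv ℝ k η z‖ ≤ Cη)
    (hηs : ∀ y, η y ≠ 0 → 1 ≤ ‖y‖) :
    ∃ C : ℝ, 0 ≤ C ∧ ∀ (lam : ℝ) (Φ : Euc d → ℝ) (ψ : Euc d → ℂ) (μ : ℝ) (xc : Euc d),
      ContDiff ℝ (⊤ : ℕ∞) Φ → ContDiff ℝ (⊤ : ℕ∞) ψ → Function.support ψ ⊆ ball 0 1 →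
      0 < lam → 0 < μ → xc ∈ closedBall (0 : Euc d) 1 →
      (∀ x ∈ closedBall (0 : Euc d) 1, μ * ‖x - xc‖ ≤ ‖fderiv ℝ Φ x‖) →
      μ ≤ Pnorm 2 Φ (ball 0 1) → μ ≤ Pnorm 3 Φ (ball 0 1) →
      (√(lam * μ))⁻¹ * Pnorm 3 Φ (ball 0 1) ≤ μ →
      ‖oscInt lam Φ (fun x => ψ x * η ((μ / (4 * Pnorm 3 Φ (ball 0 1)))⁻¹ • (x - xc)))‖ ≤
        C * ((1 + (Pnorm N Φ (ball 0 1) / Pnorm 3 Φ (ball 0 1)) ^ N) * CnormNat N ψ (ball 0 1)) *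
          ((lam * (√(lam * Pnorm 2 Φ (ball 0 1)))⁻¹ * μ *
            (μ / (4 * Pnorm 3 Φ (ball 0 1)))) ^ N)⁻¹ := by
  obtain ⟨C, hC0, hC⟩ := exists_localized_bound d N hN hη hηb
  set v₀ := volume.real (ball (0 : Euc d) 1) with hv₀
  refine ⟨C * 2 ^ N * (3 ^ d * v₀), by positivity,
    fun lam Φ ψ μ xc hΦ hψ hsupp hlam hμ hxc hgap hμP2 hμP haP => ?_⟩
  set P := Pnorm 3 Φ (ball 0 1) with hP
  set P2 := Pnorm 2 Φ (ball 0 1) with hP2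
  set R := Pnorm N Φ (ball 0 1) / P with hR
  set r := μ / (4 * P) with hr
  set a := (√(lam * μ))⁻¹ with ha
  set s := (√(lam * P2))⁻¹ with hs
  have hP0 : 0 < P := hμ.trans_le hμP
  have hP20 : 0 < P2 := hμ.trans_le hμP2
  have hr0 : 0 < r := by positivity
  have hs0 : 0 < s := by positivity
  have hPN0 : 0 ≤ Pnorm N Φ (ball 0 1) := Finset.sum_nonneg fun k _ => supDeriv_nonneg k _ _
  have hCψ : 0 ≤ CnormNat N ψ (ball 0 1) := Finset.sum_nonneg fun k _ => supDeriv_nonneg k _ _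
  have hR0 : 0 ≤ R := by positivity
  have hsa : s ≤ a := by
    rw [hs, ha]
    gcongr
  have hs2 : lam * P2 * s ^ 2 = 1 := by
    rw [hs, inv_pow, Real.sq_sqrt (by positivity), mul_inv_cancel₀ (by positivity)]
  have ha4 : a ≤ 4 * r := by
    rw [hr, mul_div_assoc', mul_div_mul_left _ _ (by norm_num), le_div_iff₀ hP0]
    exact haP
  have ha1 : a ≤ 1 := by
    have : a * P ≤ 1 * P := by linarith
    exact le_of_mul_le_mul_right this hP0
  have hs1 : s ≤ 1 := hsa.trans ha1
  set A : Euc d →L[ℝ] Euc d := s • ContinuousLinearMap.id ℝ (Euc d) with hA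
  have hAz : ∀ z, A z = s • z := fun z => by simp [hA]
  have hAn : ‖A‖ ≤ s := by
    refine ContinuousLinearMap.opNorm_le_bound _ hs0.le fun z => ?_
    rw [hAz, norm_smul, Real.norm_of_nonneg hs0.le]
  have hAdet : A.det = s ^ d := by
    change LinearMap.det (s • LinearMap.id : Euc d →ₗ[ℝ] Euc d) = _
    rw [LinearMap.det_smul, LinearMap.det_id, finrank_euclideanSpace_fin, mul_one]
  set t := lam * s * μ * r with ht
  have ht0 : 0 < t := by positivity
  set H : Euc d → ℝ := (closedBall (0 : Euc d) (3 / s)).indicator fun _ => (t ^ N)⁻¹ with hH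
  have hHi : Integrable H :=
    (integrableOn_const measure_closedBall_lt_top.ne).integrable_indicator measurableSet_closedBall
  have hH0 : ∀ w, 0 ≤ H w := indicator_nonneg fun _ _ => by positivity
  have hHI : ∫ w, H w = (3 / s) ^ d * v₀ * (t ^ N)⁻¹ := by
    rw [hH, integral_indicator measurableSet_closedBall, setIntegral_const, smul_eq_mul,
      Measure.real, Measure.addHaar_closedBall _ _ (by positivity), finrank_euclideanSpace_fin,
      ENNReal.toReal_mul, ENNReal.toReal_ofReal (by positivity)]
    rfl
  have hgrad : ∀ z, xc + A z ∈ closedBall (0 : Euc d) 1 → η (r⁻¹ • A z) ≠ 0 →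
      t ≤ ‖fderiv ℝ (fun z => lam * Φ (xc + A z)) z‖ := by
    intro z hz hηz
    have h1 := hηs _ hηz
    rw [norm_smul, norm_inv, Real.norm_of_nonneg hr0.le, le_inv_mul_iff₀ hr0, mul_one] at h1
    have h2 := hgap _ hz
    rw [add_sub_cancel_left] at h2
    rw [fderiv_phase hΦ, hA, ContinuousLinearMap.comp_smul, ContinuousLinearMap.comp_id, norm_smul,
      norm_smul, Real.norm_of_nonneg hlam.le, Real.norm_of_nonneg hs0.le, ht, ← hA]
    calc lam * s * μ * r = lam * (s * (μ * r)) := by ring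
      _ ≤ lam * (s * (μ * ‖A z‖)) := by gcongr
      _ ≤ _ := by gcongr
  have hhess : ∀ z, xc + A z ∈ closedBall (0 : Euc d) 1 →
      ‖iteratedFDeriv ℝ 2 (fun z => lam * Φ (xc + A z)) z‖ ≤ 1 := by
    intro z hz
    have hlΦ : ContDiff ℝ (⊤ : ℕ∞) (lam • Φ) := contDiff_const.smul hΦ
    have h1 := norm_iteratedFDeriv_comp_affine_le hlΦ xc A 2 z
    rw [iteratedFDeriv_const_smul_apply (contDiff_infty.mp hΦ 2).contDiffAt, norm_smul,
      Real.norm_of_nonneg hlam.le] at h1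
    refine h1.trans ?_
    rw [← hs2]
    gcongr
    exact (norm_iteratedFDeriv_le_supDeriv hΦ 2 hz).trans (supDeriv_le_Pnorm _ _ le_rfl le_rfl)
  have hmax : 1 ≤ max 1 R := le_max_left _ _
  have key := hC lam Φ ψ xc r (2 * max 1 R) A (closedBall 0 1) H hΦ hψ hsupp hr0 (by linarith)
    (by rw [hAdet]; positivity) (hAn.trans hs1) (hAn.trans (hsa.trans ha4))
    (convex_closedBall _ _) isClosed_closedBall subset_rfl
    (fun x hx _ => ball_subset_closedBall hx)
    (fun z hz k hk hkN => by
      obtain rfl | hk3 : k = 2 ∨ 3 ≤ k := by omega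
      · exact (hhess z hz).trans (by linarith)
      · refine (norm_iteratedFDeriv_phase_le hΦ hlam hμ (hAn.trans hs1) (hAn.trans hsa) hP0 haP hz
          hk3 hkN).trans ?_
        linarith [le_max_right 1 R])
    hHi hH0
    (fun w z hz hηz hzw => by
      have h1 := hgrad z hz hηz
      have h2 : ‖w‖ ≤ ‖z‖ + 1 := by
        have := norm_sub_norm_le w z
        rw [norm_sub_rev] at this
        linarith
      have h3 : s * ‖z‖ ≤ 2 := by
        have h4 := norm_sub_le (xc + A z) xc
        rw [add_sub_cancel_left, hAz, norm_smul, Real.norm_of_nonneg hs0.le, ← hAz] at h4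
        rw [mem_closedBall_zero_iff] at hz hxc
        linarith
      have hw : w ∈ closedBall (0 : Euc d) (3 / s) := by
        rw [mem_closedBall_zero_iff, le_div_iff₀ hs0]
        nlinarith
      rw [hH, indicator_of_mem hw]
      calc (1 : ℝ) = (t ^ N)⁻¹ * t ^ N := (inv_mul_cancel₀ (by positivity)).symm
        _ ≤ _ := by
            gcongr
            linarith)
  refine key.trans ?_
  rw [hAdet, hHI, abs_of_nonneg (by positivity)]
  have hM := two_mul_max_one_pow_le hR0 N
  calc _ ≤ s ^ d * (C * (2 ^ N * (1 + R ^ N) * CnormNat N ψ (ball 0 1)) *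
        ((3 / s) ^ d * v₀ * (t ^ N)⁻¹)) := by gcongr
    _ = C * (2 ^ N * (1 + R ^ N) * CnormNat N ψ (ball 0 1)) *
        ((s * (3 / s)) ^ d * v₀ * (t ^ N)⁻¹) := by ring
    _ = _ := by
        rw [mul_div_cancel₀ _ hs0.ne']
        ring

end StationaryPhase

section MainEstimate

lemma exists_cutoff (d N : ℕ) :
    ∃ (η : Euc d → ℂ) (C : ℝ), ContDiff ℝ (⊤ : ℕ∞) η ∧
      (∀ k ≤ N, ∀ z, ‖iteratedFDeriv ℝ k η z‖ ≤ C) ∧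
      (∀ k ≤ N, ∀ z, ‖iteratedFDeriv ℝ k (fun y => 1 - η y) z‖ ≤ C) ∧
      (∀ y, η y ≠ 0 → ‖y‖ ≤ 2) ∧ ∀ y, 1 - η y ≠ 0 → 1 ≤ ‖y‖ := by
  let f : ContDiffBump (0 : Euc d) := ⟨1, 2, one_pos, one_lt_two⟩
  have hf : ContDiff ℝ (⊤ : ℕ∞) fun y => (f y : ℂ) := Complex.ofRealCLM.contDiff.comp f.contDiff
  have hc : HasCompactSupport fun y => (f y : ℂ) :=
    f.hasCompactSupport.comp_left Complex.ofReal_zero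
  obtain ⟨C, hC0, hC⟩ := exists_iteratedFDeriv_bound hf hc N
  refine ⟨fun y => (f y : ℂ), 1 + C, hf, fun k hk z => (hC k hk z).trans (by linarith),
    fun k hk z => ?_, fun y hy => ?_, fun y hy => ?_⟩
  · have hfk : ContDiffAt ℝ k (fun y => (f y : ℂ)) z := (contDiff_infty.mp hf k).contDiffAt
    have h1 : iteratedFDeriv ℝ k (fun y => 1 - (f y : ℂ)) z =
        iteratedFDeriv ℝ k (fun _ => (1 : ℂ)) z - iteratedFDeriv ℝ k (fun y => (f y : ℂ)) z :=
      iteratedFDeriv_sub_apply contDiffAt_const hfk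
    have h2 : ‖iteratedFDeriv ℝ k (fun _ : Euc d => (1 : ℂ)) z‖ ≤ 1 := by
      obtain rfl | hk0 := Nat.eq_zero_or_pos k
      · simp
      · rw [iteratedFDeriv_const_of_ne hk0.ne']
        simp
    rw [h1]
    exact (norm_sub_le _ _).trans (add_le_add h2 (hC k hk z))
  · have h : y ∈ Function.support f := by
      simpa using hy
    rw [f.support_eq, mem_ball_zero_iff] at h
    exact h.le
  · by_contra! h
    refine hy ?_
    simp [f.one_of_mem_closedBall (mem_closedBall_zero_iff.mpr h.le)]

lemma norm_oscInt_le {d : ℕ} (N : ℕ) (lam : ℝ) (Φ : Euc d → ℝ) {ψ : Euc d → ℂ}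
    (hψ : ContDiff ℝ (⊤ : ℕ∞) ψ) (hsupp : Function.support ψ ⊆ ball 0 1) :
    ‖oscInt lam Φ ψ‖ ≤ CnormNat N ψ (ball 0 1) * volume.real (ball (0 : Euc d) 1) := by
  rw [oscInt, ← setIntegral_eq_integral_of_forall_compl_eq_zero (s := ball 0 1)
    fun x hx => by rw [Function.notMem_support.mp fun h => hx (hsupp h), mul_zero]]
  refine norm_setIntegral_le_of_norm_le_const measure_ball_lt_top fun x hx => ?_
  rw [norm_mul, mul_assoc, ← Complex.ofReal_mul, mul_comm Complex.I,
    Complex.norm_exp_ofReal_mul_I, one_mul, ← norm_iteratedFDeriv_zero (𝕜 := ℝ)]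
  exact (norm_iteratedFDeriv_le_supDeriv hψ 0 (ball_subset_closedBall hx)).trans
    (supDeriv_le_CnormNat _ _ (Nat.zero_le N))

lemma oscInt_add {d : ℕ} (lam : ℝ) {Φ : Euc d → ℝ} (hΦ : Continuous Φ) {f g : Euc d → ℂ}
    (hf : Continuous f) (hfc : HasCompactSupport f) (hg : Continuous g)
    (hgc : HasCompactSupport g) :
    oscInt lam Φ (fun x => f x + g x) = oscInt lam Φ f + oscInt lam Φ g := by
  have he : Continuous fun x => Complex.exp (Complex.I * lam * (Φ x : ℂ)) := by fun_prop
  simp only [oscInt, mul_add]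
  exact integral_add ((he.mul hf).integrable_of_hasCompactSupport hfc.mul_left)
    ((he.mul hg).integrable_of_hasCompactSupport hgc.mul_left)

/-- Above the threshold `L ^ (1 + ε)`, enough integrations by parts gain `lam ^ (-d / 2)`. -/
lemma inv_pow_le_of_threshold {L lam ε t : ℝ} {d N : ℕ} (hε : 0 < ε) (hL : 0 < L) (hlam : 1 ≤ lam)
    (hLlam : L ≤ lam ^ (1 + ε)⁻¹) (hN : (d : ℝ) * (1 + ε) / ε ≤ N) (ht : 0 < t)
    (htL : (4 * t) ^ 2 * L = lam) : (t ^ N)⁻¹ ≤ 4 ^ N * lam ^ (-(d : ℝ) / 2) := by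
  have hlam0 : 0 < lam := by linarith
  have h1 : lam ^ (ε / (1 + ε)) ≤ (4 * t) ^ 2 := by
    have h2 : lam ^ (ε / (1 + ε)) * lam ^ (1 + ε)⁻¹ = lam := by
      rw [← Real.rpow_add hlam0]
      have : ε / (1 + ε) + (1 + ε)⁻¹ = 1 := by field_simp; ring
      rw [this, Real.rpow_one]
    refine le_of_mul_le_mul_right ?_ hL
    rw [htL]
    calc _ ≤ lam ^ (ε / (1 + ε)) * lam ^ (1 + ε)⁻¹ := by gcongr
      _ = lam := h2
  have h3 : lam ^ ((d : ℝ) / 2) ≤ (4 * t) ^ N := by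
    calc lam ^ ((d : ℝ) / 2) ≤ lam ^ (ε / (1 + ε) * (N / 2)) := by
          refine Real.rpow_le_rpow_of_exponent_le hlam ?_
          rw [div_le_iff₀ hε] at hN
          rw [div_mul_div_comm, div_le_div_iff₀ (by norm_num) (by positivity)]
          linarith
      _ = (lam ^ (ε / (1 + ε))) ^ ((N : ℝ) / 2) := Real.rpow_mul hlam0.le _ _
      _ ≤ ((4 * t) ^ 2) ^ ((N : ℝ) / 2) := by gcongr
      _ = (4 * t) ^ N := by
          rw [← Real.rpow_natCast (4 * t) 2, ← Real.rpow_mul (by positivity),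
            ← Real.rpow_natCast (4 * t) N]
          congr 1
          push_cast
          ring
  rw [neg_div, Real.rpow_neg hlam0.le, inv_le_iff_one_le_mul₀ (by positivity)]
  have h4 : 0 < lam ^ ((d : ℝ) / 2) := by positivity
  calc (1 : ℝ) = lam ^ ((d : ℝ) / 2) * (lam ^ ((d : ℝ) / 2))⁻¹ := (mul_inv_cancel₀ h4.ne').symm
    _ ≤ (4 * t) ^ N * (lam ^ ((d : ℝ) / 2))⁻¹ := by gcongr
    _ = _ := by ring

lemma norm_gradient_sub {E : Type*} [NormedAddCommGroup E] [InnerProductSpace ℝ E]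
    [CompleteSpace E] (Φ : E → ℝ) (x y : E) :
    ‖gradient Φ x - gradient Φ y‖ = ‖fderiv ℝ Φ x - fderiv ℝ Φ y‖ := by
  rw [gradient, gradient, ← map_sub, LinearIsometryEquiv.norm_map]

end MainEstimate

/-- Theorem `optimal`: stationary phase estimate with the bound
`(1 + |det HΦ(x_c)|^{-1/2}) λ^{-d/2}` for `λ ≥ λ₀^{1+ε}`, where `λ₀ = 𝒫₃² 𝒫₂ μ⁻⁴`,
`N_ε = [d(1+ε)/ε] + 1` and `𝔠_n = (1 + (𝒫_n/𝒫₃)^n) 𝒜_n`. -/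
theorem stmt6 (d : ℕ) (hd : 1 ≤ d) (ε : ℝ) (hε : 0 < ε) :
    ∃ C : ℝ, 0 < C ∧
      ∀ (lam : ℝ) (Φ : Euc d → ℝ) (ψ : Euc d → ℂ) (μ : ℝ) (xc : Euc d),
        ContDiff ℝ (⊤ : ℕ∞) Φ →
        ContDiff ℝ (⊤ : ℕ∞) ψ →
        Function.support ψ ⊆ ball 0 1 →
        0 < μ →
        (∀ x ∈ closedBall (0 : Euc d) 1, ∀ y ∈ closedBall (0 : Euc d) 1,
          μ * ‖x - y‖ ≤ ‖gradient Φ x - gradient Φ y‖) →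
        gradient Φ xc = 0 →
        xc ∈ tsupport ψ →
        (Pnorm 3 Φ (ball 0 1) ^ 2 * Pnorm 2 Φ (ball 0 1) / μ ^ 4) ^ (1 + ε) ≤ lam →
        ‖oscInt lam Φ ψ‖ ≤
          C * ((1 + (Pnorm (⌊(d : ℝ) * (1 + ε) / ε⌋₊ + 1) Φ (ball 0 1) /
                  Pnorm 3 Φ (ball 0 1)) ^ (⌊(d : ℝ) * (1 + ε) / ε⌋₊ + 1)) *
              CnormNat (⌊(d : ℝ) * (1 + ε) / ε⌋₊ + 1) ψ (ball 0 1)) *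
            (1 + |(Hess Φ xc).det| ^ (-(1 : ℝ) / 2)) * lam ^ (-(d : ℝ) / 2) := by
  set N := ⌊(d : ℝ) * (1 + ε) / ε⌋₊ + 1 with hNdef
  have hNε : (d : ℝ) * (1 + ε) / ε ≤ N := by
    rw [hNdef]
    push_cast
    exact (Nat.lt_floor_add_one _).le
  have hdN : d < N := by
    rw [hNdef, Nat.lt_succ_iff]
    refine Nat.le_floor ?_
    rw [le_div_iff₀ hε]
    have : (0 : ℝ) ≤ d := d.cast_nonneg
    nlinarith
  obtain ⟨η, Cη, hη, hηb, hηb', hηs, hηs'⟩ := exists_cutoff d N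
  obtain ⟨Cn, hCn0, hnear⟩ := exists_near_bound d N (by omega) hdN hη hηb hηs
  obtain ⟨Cf, hCf0, hfar⟩ :=
    exists_far_bound d N (by omega) (contDiff_const.sub hη) hηb' hηs'
  set v₀ := volume.real (ball (0 : Euc d) 1) with hv₀
  have hv₀0 : 0 ≤ v₀ := measureReal_nonneg
  refine ⟨Cn + Cf * 4 ^ N + v₀ + 1, by positivity,
    fun lam Φ ψ μ xc hΦ hψ hsupp hμ hgap hcrit hxcψ hlam => ?_⟩
  have hxc : xc ∈ closedBall (0 : Euc d) 1 :=
    closure_minimal (hsupp.trans ball_subset_closedBall) isClosed_closedBall hxcψ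
  have hcrit' : fderiv ℝ Φ xc = 0 := by
    rwa [gradient, map_eq_zero_iff _ (LinearIsometryEquiv.injective _)] at hcrit
  simp only [norm_gradient_sub] at hgap
  have hgap2 : ∀ v, μ * ‖v‖ ≤ ‖fderiv ℝ (fderiv ℝ Φ) xc v‖ :=
    le_norm_fderiv_apply_of_le_norm_sub (contDiff_infty.mp (hΦ.fderiv_right (by simp)) 1)
      isOpen_ball
      (fun x hx y hy => hgap x (ball_subset_closedBall hx) y (ball_subset_closedBall hy))
      (by rwa [closure_ball _ one_ne_zero])
  have hμP2 : μ ≤ Pnorm 2 Φ (ball 0 1) := by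
    have h1 := hgap2 (EuclideanSpace.single ⟨0, hd⟩ 1)
    have h2 := (fderiv ℝ (fderiv ℝ Φ) xc).le_opNorm (EuclideanSpace.single ⟨0, hd⟩ 1)
    rw [PiLp.norm_single, norm_one, mul_one] at h1 h2
    refine (h1.trans h2).trans ?_
    rw [norm_fderiv_fderiv]
    exact (norm_iteratedFDeriv_le_supDeriv hΦ 2 hxc).trans (supDeriv_le_Pnorm _ _ le_rfl le_rfl)
  have hμP3 : μ ≤ Pnorm 3 Φ (ball 0 1) := hμP2.trans (Pnorm_mono _ _ (by norm_num))
  specialize hnear lam Φ ψ μ xc hΦ hψ hsupp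
  specialize hfar lam Φ ψ μ xc hΦ hψ hsupp
  have htriv := norm_oscInt_le N lam Φ hψ hsupp
  set P := Pnorm 3 Φ (ball 0 1) with hP
  set P2 := Pnorm 2 Φ (ball 0 1) with hP2
  set Q := (Pnorm N Φ (ball 0 1) / P) ^ N with hQ
  set Cψ := CnormNat N ψ (ball 0 1) with hCψ
  set D := |(Hess Φ xc).det| ^ (-(1 : ℝ) / 2) with hD
  have hP0 : 0 < P := hμ.trans_le hμP3
  have hP20 : 0 < P2 := hμ.trans_le hμP2
  have hQ0 : 0 ≤ Q :=
    pow_nonneg (div_nonneg (Finset.sum_nonneg fun k _ => supDeriv_nonneg k _ _) hP0.le) N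
  have hCψ0 : 0 ≤ Cψ := Finset.sum_nonneg fun k _ => supDeriv_nonneg k _ _
  have hD0 : 0 ≤ D := by positivity
  have hL0 : 0 < P ^ 2 * P2 / μ ^ 4 := by positivity
  have hlam0 : 0 < lam := (Real.rpow_pos_of_pos hL0 _).trans_le hlam
  obtain hlam1 | hlam1 := le_total lam 1
  · have h1 : 1 ≤ lam ^ (-(d : ℝ) / 2) := by
      refine Real.one_le_rpow_of_pos_of_le_one_of_nonpos hlam0 hlam1 ?_
      have : (0 : ℝ) ≤ d := d.cast_nonneg
      linarith
    calc ‖oscInt lam Φ ψ‖ ≤ v₀ * ((1 + 0) * Cψ) * (1 + 0) * 1 := by linarith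
      _ ≤ (Cn + Cf * 4 ^ N + v₀ + 1) * ((1 + Q) * Cψ) * (1 + D) * lam ^ (-(d : ℝ) / 2) := by
          gcongr
          have : 0 ≤ Cf * 4 ^ N := by positivity
          linarith
  have hLlam : P ^ 2 * P2 / μ ^ 4 ≤ lam ^ (1 + ε)⁻¹ :=
    (Real.le_rpow_inv_iff_of_pos hL0.le hlam0.le (by linarith)).mpr hlam
  have hLlam' : P ^ 2 * P2 / μ ^ 4 ≤ lam := by
    refine hLlam.trans ((Real.rpow_le_rpow_of_exponent_le hlam1 ?_).trans_eq (Real.rpow_one lam))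
    exact inv_le_one_of_one_le₀ (by linarith)
  have haP : (√(lam * μ))⁻¹ * P ≤ μ := by
    rw [inv_mul_le_iff₀ (by positivity)]
    refine le_of_sq_le_sq ?_ (by positivity)
    rw [mul_pow, Real.sq_sqrt (by positivity)]
    rw [div_le_iff₀ (by positivity)] at hLlam'
    refine le_of_mul_le_mul_right ?_ hμ
    calc P ^ 2 * μ ≤ P ^ 2 * P2 := by gcongr
      _ ≤ lam * μ ^ 4 := hLlam'
      _ = _ := by ring
  have hnear := hnear hlam0 hμ hxc hcrit' hgap2 hμP3 haP
  have hfar := hfar hlam0 hμ hxc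
    (fun x hx => by simpa [hcrit'] using hgap x hx xc hxc) hμP2 hμP3 haP
  set r := μ / (4 * P) with hr
  have hψc : HasCompactSupport ψ := HasCompactSupport.of_support_subset_isCompact
    (isCompact_closedBall 0 1) (hsupp.trans ball_subset_closedBall)
  have hcont : Continuous fun x => η (r⁻¹ • (x - xc)) := hη.continuous.comp (by fun_prop)
  have hsplit : oscInt lam Φ ψ = oscInt lam Φ (fun x => ψ x * η (r⁻¹ • (x - xc))) +
      oscInt lam Φ (fun x => ψ x * (1 - η (r⁻¹ • (x - xc)))) := by
    refine Eq.trans ?_ (oscInt_add lam hΦ.continuous (hψ.continuous.mul hcont) hψc.mul_right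
      (hψ.continuous.mul (continuous_const.sub hcont)) hψc.mul_right)
    congr 1
    funext x
    ring
  have ht := inv_pow_le_of_threshold (t := lam * (√(lam * P2))⁻¹ * μ * r) hε hL0 hlam1 hLlam hNε
    (by positivity) (by
      have hs : ((√(lam * P2))⁻¹) ^ 2 = (lam * P2)⁻¹ := by
        rw [inv_pow, Real.sq_sqrt (by positivity)]
      rw [mul_pow, mul_pow, mul_pow, mul_pow, hs, hr]
      field_simp)
  rw [hsplit]
  calc _ ≤ _ := norm_add_le _ _
    _ ≤ Cn * ((1 + Q) * Cψ) * (D * lam ^ (-(d : ℝ) / 2)) +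
        Cf * ((1 + Q) * Cψ) * (4 ^ N * lam ^ (-(d : ℝ) / 2)) := by
        refine add_le_add hnear (hfar.trans ?_)
        gcongr
    _ = (Cn * D + Cf * 4 ^ N * 1) * ((1 + Q) * Cψ) * lam ^ (-(d : ℝ) / 2) := by ring
    _ ≤ ((Cn + Cf * 4 ^ N + v₀ + 1) * (1 + D)) * ((1 + Q) * Cψ) * lam ^ (-(d : ℝ) / 2) := by
        gcongr
        have : 0 ≤ Cf * 4 ^ N := by positivity
        nlinarith [mul_nonneg hv₀0 hD0, mul_nonneg this hD0]
    _ = _ := by ring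

end
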